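/- Let (X,d) be a compact metric space and f : X → X a continuous map. Suppose there exists a point x ∈ X which is non-periodic (its forward orbit {f^k(x) : k ≥ 0} is infinite), shadowable, uniformly positively expansive, nonwandering, and not an isolated point of X. Then there exist an integer m ≥ 1 and a nonempty closed subset Y ⊆ X with f^m(Y) ⊆ Y such that (Y, f^m|_Y) is topologically conjugate to the full shift (Σ, σ). In particular, the topological entropy of f is positive. -/

import Mathlib

open Filter Topology Set
open scoped ENNReal

variable {X : Type*}

/-- A sequence `(x i)` is a `δ`-pseudo-orbit for `f` if `dist (f (x i)) (x (i+1)) < δ`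
for every `i ≥ 0`. -/
def IsPseudoOrbit [MetricSpace X] (f : X → X) (δ : ℝ) (x : ℕ → X) : Prop :=
  ∀ i : ℕ, dist (f (x i)) (x (i + 1)) < δ

/-- A sequence `(x i)` is `ε`-shadowed by the point `y`. -/
def IsShadowedBy [MetricSpace X] (f : X → X) (ε : ℝ) (x : ℕ → X) (y : X) : Prop :=
  ∀ i : ℕ, dist (f^[i] y) (x i) < ε

/-- A point `x₀` is shadowable: for every `ε > 0` there is `δ > 0` such that every
`δ`-pseudo-orbit starting at `x₀` is `ε`-shadowed by some point. -/
def ShadowablePoint [MetricSpace X] (f : X → X) (x₀ : X) : Prop :=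
  ∀ ε > (0 : ℝ), ∃ δ > (0 : ℝ), ∀ x : ℕ → X, IsPseudoOrbit f δ x → x 0 = x₀ →
    ∃ y : X, IsShadowedBy f ε x y

/-- `f` has the shadowing property. -/
def ShadowingProperty [MetricSpace X] (f : X → X) : Prop :=
  ∀ ε > (0 : ℝ), ∃ δ > (0 : ℝ), ∀ x : ℕ → X, IsPseudoOrbit f δ x →
    ∃ y : X, IsShadowedBy f ε x y

/-- A sequence of maps `F n` has the uniform shadowing property: each `F n` has the shadowing
property and, for every `ε > 0`, one single `δ > 0` works for all the maps `F n`. -/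
def UniformShadowing [MetricSpace X] (F : ℕ → X → X) : Prop :=
  (∀ n, ShadowingProperty (F n)) ∧
    ∀ ε > (0 : ℝ), ∃ δ > (0 : ℝ), ∀ n, ∀ x : ℕ → X, IsPseudoOrbit (F n) δ x →
      ∃ y : X, IsShadowedBy (F n) ε x y

/-- A point `x` is nonwandering for `f` if every neighborhood `U` of `x` satisfies
`f^n(U) ∩ U ≠ ∅` for some `n ≥ 1`. -/
def NonwanderingPt [MetricSpace X] (f : X → X) (x : X) : Prop :=
  ∀ U ∈ 𝓝 x, ∃ n : ℕ, 1 ≤ n ∧ (f^[n] '' U ∩ U).Nonempty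

/-- `s_n(V, ε)`: the maximal cardinality of an `(n, ε)`-separated subset of `V`. -/
noncomputable def sepNum [MetricSpace X] (f : X → X) (V : Set X) (n : ℕ) (ε : ℝ) : ℕ :=
  sSup {k : ℕ | ∃ E : Finset X, ↑E ⊆ V ∧ E.card = k ∧
    ∀ x ∈ E, ∀ y ∈ E, x ≠ y → ∃ i ≤ n, ε ≤ dist (f^[i] x) (f^[i] y)}

/-- `lim_{ε → 0} limsup_{n → ∞} (1/n) log s_n(V, ε)`, as a supremum over `ε > 0`
(the inner quantity is monotone as `ε` decreases). -/
noncomputable def entropyWithin [MetricSpace X] (f : X → X) (V : Set X) : ℝ≥0∞ :=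
  ⨆ (ε : ℝ) (_ : 0 < ε),
    Filter.limsup (fun n : ℕ => ENNReal.ofReal (Real.log (sepNum f V n ε) / n)) Filter.atTop

/-- The topological entropy of `f`. -/
noncomputable def topEntropy [MetricSpace X] (f : X → X) : ℝ≥0∞ :=
  entropyWithin f Set.univ

/-- `x` is a uniformly positively expansive point: there are a neighborhood `U` of `x` and
`e > 0` such that any two points of `U` whose orbits stay `e`-close forever are equal. -/
def UnifPosExpansivePt [MetricSpace X] (f : X → X) (x : X) : Prop :=
  ∃ U ∈ 𝓝 x, ∃ e > (0 : ℝ), ∀ y ∈ U, ∀ z ∈ U,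
    (∀ i : ℕ, dist (f^[i] y) (f^[i] z) < e) → y = z

/-- The sequence which, on each block `[j * m, (j + 1) * m)`, follows the orbit of `c j`, except
that it is placed at `x` at the beginning of the block. -/
def blockOrbit (f : X → X) (x : X) (m : ℕ) (c : ℕ → X) (i : ℕ) : X :=
  if i % m = 0 then x else f^[i % m] (c (i / m))

lemma blockOrbit_zero (f : X → X) (x : X) (m : ℕ) (c : ℕ → X) : blockOrbit f x m c 0 = x := by
  simp [blockOrbit]

lemma blockOrbit_mul (f : X → X) (x : X) (m : ℕ) (c : ℕ → X) (j : ℕ) :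
    blockOrbit f x m c (j * m) = x := by
  simp [blockOrbit]

lemma blockOrbit_add_self (f : X → X) (x : X) {m : ℕ} (hm : 0 < m) (c : ℕ → X) (i : ℕ) :
    blockOrbit f x m c (i + m) = blockOrbit f x m (fun j => c (j + 1)) i := by
  simp [blockOrbit, Nat.add_div_right _ hm]

lemma blockOrbit_mul_add (f : X → X) (x : X) {m : ℕ} (c : ℕ → X) (j : ℕ) {i : ℕ}
    (hi : 0 < i) (him : i < m) : blockOrbit f x m c (j * m + i) = f^[i] (c j) := by
  have h1 : (j * m + i) % m = i := by
    rw [add_comm, Nat.add_mul_mod_self_right, Nat.mod_eq_of_lt him]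
  have h2 : (j * m + i) / m = j := by
    rw [add_comm, Nat.add_mul_div_right _ _ (hi.trans him), Nat.div_eq_of_lt him, zero_add]
  simp [blockOrbit, h1, h2, hi.ne']

lemma isPseudoOrbit_blockOrbit [MetricSpace X] {f : X → X} {x : X} {m : ℕ} (hm : 0 < m)
    {c : ℕ → X} {δ : ℝ} (hstart : ∀ j, dist (f x) (f (c j)) < δ / 2)
    (hend : ∀ j, dist (f^[m] (c j)) x < δ / 2) : IsPseudoOrbit f δ (blockOrbit f x m c) := by
  intro i
  have hδ : 0 < δ / 2 := dist_nonneg.trans_lt (hstart 0)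
  have hlt := Nat.mod_lt i hm
  have h1 : dist (f (blockOrbit f x m c i)) (f^[i % m + 1] (c (i / m))) < δ / 2 := by
    unfold blockOrbit
    split_ifs with h
    · simpa [h] using hstart (i / m)
    · simpa [Function.iterate_succ_apply'] using hδ
  have h2 : dist (f^[i % m + 1] (c (i / m))) (blockOrbit f x m c (i + 1)) < δ / 2 := by
    have hi : i + 1 = i / m * m + (i % m + 1) := by
      have := Nat.div_add_mod' i m
      omega
    rcases (Nat.succ_le_of_lt hlt).lt_or_eq with h | h
    · rw [hi, blockOrbit_mul_add f x c _ (Nat.succ_pos _) h]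
      simpa using hδ
    · have h' : i % m + 1 = m := h
      rw [hi, h', ← Nat.succ_mul, blockOrbit_mul]
      exact hend _
  linarith [dist_triangle (f (blockOrbit f x m c i)) (f^[i % m + 1] (c (i / m)))
    (blockOrbit f x m c (i + 1))]

lemma exists_pos_forall_dist_lt_half [MetricSpace X] {f : X → X} (hf : Continuous f) (x : X)
    {δ : ℝ} (hδ : 0 < δ) :
    ∃ r > 0, r ≤ δ / 2 ∧ ∀ y, dist y x < r → dist (f x) (f y) < δ / 2 := by
  obtain ⟨r, hr, h⟩ := Metric.continuous_iff.1 hf x (δ / 2) (half_pos hδ)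
  refine ⟨min r (δ / 2), lt_min hr (half_pos hδ), min_le_right _ _, fun y hy => ?_⟩
  rw [dist_comm]
  exact h y (hy.trans_le (min_le_left _ _))

lemma ShadowablePoint.exists_isPeriodicPt [MetricSpace X] {f : X → X} (hf : Continuous f) {x : X}
    (hshad : ShadowablePoint f x) (hexp : UnifPosExpansivePt f x) (hnw : NonwanderingPt f x)
    {ε : ℝ} (hε : 0 < ε) :
    ∃ z, dist z x < ε ∧ ∃ n, 0 < n ∧ Function.IsPeriodicPt f n z := by
  obtain ⟨U, hU, e, he, hexp⟩ := hexp
  obtain ⟨ρ, hρ, hρU⟩ := Metric.mem_nhds_iff.1 hU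
  obtain ⟨δ, hδ, hsh⟩ := hshad (min (min ε ρ) (e / 2)) (by positivity)
  obtain ⟨r, hr, hrδ, hfr⟩ := exists_pos_forall_dist_lt_half hf x hδ
  obtain ⟨n, hn, _, ⟨y, hy, rfl⟩, hy'⟩ := hnw _ (Metric.ball_mem_nhds x hr)
  obtain ⟨z, hz⟩ := hsh (blockOrbit f x n fun _ => y)
    (isPseudoOrbit_blockOrbit hn (fun _ => hfr y hy)
      fun _ => (Metric.mem_ball.1 hy').trans_le hrδ) (blockOrbit_zero ..)
  have hz' : ∀ i, dist (f^[i] (f^[n] z)) (blockOrbit f x n (fun _ => y) i) <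
      min (min ε ρ) (e / 2) := fun i => by
    rw [← Function.iterate_add_apply, ← blockOrbit_add_self f x hn (fun _ => y) i]
    exact hz (i + n)
  have h0 := hz 0
  have h0' := hz' 0
  simp only [blockOrbit_zero, Function.iterate_zero, id, lt_min_iff] at h0 h0'
  refine ⟨z, h0.1.1, n, hn, hexp _ (hρU h0'.1.2) _ (hρU h0.1.2) fun i => ?_⟩
  have h1 := (hz i).trans_le (min_le_right _ _)
  have h2 := (hz' i).trans_le (min_le_right _ _)
  linarith [dist_triangle_right (f^[i] (f^[n] z)) (f^[i] z) (blockOrbit f x n (fun _ => y) i)]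

lemma continuous_of_isClosed_setOf_eq {C K : Type*} [TopologicalSpace C] [TopologicalSpace K]
    [CompactSpace K] {Φ : C → K} (h : IsClosed {q : C × K | q.2 = Φ q.1}) : Continuous Φ := by
  refine continuous_iff_isClosed.2 fun s hs => ?_
  have : Φ ⁻¹' s = Prod.fst '' ({q : C × K | q.2 = Φ q.1} ∩ Prod.snd ⁻¹' s) := by
    ext c
    simp
  rw [this]
  exact isClosedMap_fst_of_compactSpace _ (h.inter (hs.preimage continuous_snd))

lemma bddAbove_card_separated [MetricSpace X] [CompactSpace X] {f : X → X} (hf : Continuous f)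
    (V : Set X) (n : ℕ) {ε : ℝ} (hε : 0 < ε) :
    BddAbove {k : ℕ | ∃ E : Finset X, ↑E ⊆ V ∧ E.card = k ∧
      ∀ x ∈ E, ∀ y ∈ E, x ≠ y → ∃ i ≤ n, ε ≤ dist (f^[i] x) (f^[i] y)} := by
  have hopen : ∀ x : X, {y | ∀ i ≤ n, dist (f^[i] y) (f^[i] x) < ε / 2} ∈ 𝓝 x := fun x => by
    refine (Set.finite_le_nat n).eventually_all.2 fun i _ => ?_
    exact (hf.iterate i).continuousAt.eventually (Metric.ball_mem_nhds _ (half_pos hε))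
  obtain ⟨t, -, ht⟩ := isCompact_univ.elim_nhds_subcover _ fun x _ => hopen x
  refine ⟨t.card, ?_⟩
  rintro _ ⟨E, -, rfl, hE⟩
  have hc : ∀ y : X, ∃ x ∈ t, ∀ i ≤ n, dist (f^[i] y) (f^[i] x) < ε / 2 := fun y => by
    simpa using ht (Set.mem_univ y)
  choose g hgt hg using hc
  refine Finset.card_le_card_of_injOn g (fun y _ => hgt y) fun y hy y' hy' hgy => ?_
  by_contra hne
  obtain ⟨i, hi, hle⟩ := hE y hy y' hy' hne
  have h1 := hg y i hi
  have h2 := hg y' i hi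
  rw [← hgy] at h2
  linarith [dist_triangle_right (f^[i] y) (f^[i] y') (f^[i] (g y))]

lemma two_pow_le_sepNum [MetricSpace X] [CompactSpace X] {f : X → X} (hf : Continuous f)
    {m : ℕ} {ε : ℝ} (hε : 0 < ε) {Φ : (ℕ → Bool) → X}
    (hΦ : ∀ c c' j, c j ≠ c' j →
      ∃ i < m, ε ≤ dist (f^[j * m + i] (Φ c)) (f^[j * m + i] (Φ c'))) (k : ℕ) :
    2 ^ k ≤ sepNum f Set.univ (k * m) ε := by
  classical
  let ext : (Fin k → Bool) → ℕ → Bool := fun w j => if h : j < k then w ⟨j, h⟩ else false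
  have hsep : ∀ w w' : Fin k → Bool, w ≠ w' →
      ∃ i ≤ k * m, ε ≤ dist (f^[i] (Φ (ext w))) (f^[i] (Φ (ext w'))) := fun w w' hne => by
    obtain ⟨j, hj⟩ := Function.ne_iff.1 hne
    obtain ⟨i, hi, hle⟩ := hΦ (ext w) (ext w') j (by simpa [ext] using hj)
    refine ⟨j * m + i, ?_, hle⟩
    have := Nat.mul_le_mul_right m (Nat.succ_le_of_lt j.2)
    rw [Nat.succ_mul] at this
    omega
  have hinj : Function.Injective fun w => Φ (ext w) := fun w w' h => by
    by_contra hne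
    obtain ⟨i, -, hle⟩ := hsep w w' hne
    rw [show Φ (ext w) = Φ (ext w') from h, dist_self] at hle
    exact hle.not_gt hε
  refine le_csSup (bddAbove_card_separated hf _ _ hε)
    ⟨Finset.univ.image fun w => Φ (ext w), Set.subset_univ _, ?_, ?_⟩
  · simp [Finset.card_image_of_injective _ hinj]
  · intro y hy y' hy' hne
    obtain ⟨w, -, rfl⟩ := Finset.mem_image.1 hy
    obtain ⟨w', -, rfl⟩ := Finset.mem_image.1 hy'
    exact hsep w w' fun h => hne (by rw [h])

lemma topEntropy_pos_of_separated_coding [MetricSpace X] [CompactSpace X] {f : X → X}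
    (hf : Continuous f) {m : ℕ} (hm : 0 < m) {ε : ℝ} (hε : 0 < ε) {Φ : (ℕ → Bool) → X}
    (hΦ : ∀ c c' j, c j ≠ c' j →
      ∃ i < m, ε ≤ dist (f^[j * m + i] (Φ c)) (f^[j * m + i] (Φ c'))) :
    0 < topEntropy f := by
  have hm' : (0 : ℝ) < m := Nat.cast_pos.2 hm
  have hpos : 0 < ENNReal.ofReal (Real.log 2 / m) :=
    ENNReal.ofReal_pos.2 (div_pos (Real.log_pos one_lt_two) hm')
  refine hpos.trans_le (le_trans ?_ (le_iSup₂_of_le ε hε le_rfl))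
  refine Filter.le_limsup_of_frequently_le (Filter.frequently_atTop.2 fun N => ?_)
  refine ⟨(N + 1) * m, (Nat.le_succ N).trans (Nat.le_mul_of_pos_right _ hm), ?_⟩
  refine ENNReal.ofReal_le_ofReal ?_
  have hlog : ((N + 1 : ℕ) : ℝ) * Real.log 2 ≤
      Real.log (sepNum f Set.univ ((N + 1) * m) ε) := by
    rw [← Real.log_pow]
    refine Real.log_le_log (by positivity) ?_
    exact_mod_cast two_pow_le_sepNum hf hε hΦ (N + 1)
  have hN : (0 : ℝ) < ((N + 1 : ℕ) : ℝ) := by positivity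
  rw [Nat.cast_mul, div_le_div_iff₀ hm' (by positivity)]
  nlinarith [mul_le_mul_of_nonneg_right hlog hm'.le]

/-- Theorem: if there is a non-periodic, shadowable, uniformly positively expansive,
nonwandering, non-isolated point, then some `(Y, f^m)` is conjugate to the full shift
`({0,1}^ℕ, σ)`, and `f` has positive topological entropy. -/
theorem stmt0 [MetricSpace X] [CompactSpace X] (f : X → X) (hf : Continuous f) (x : X)
    (hnonper : (Set.range fun k : ℕ => f^[k] x).Infinite)
    (hshad : ShadowablePoint f x)
    (hexp : UnifPosExpansivePt f x)
    (hnw : NonwanderingPt f x)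
    (hnotisol : (𝓝[≠] x).NeBot) :
    (∃ m : ℕ, 1 ≤ m ∧ ∃ Y : Set X, Y.Nonempty ∧ IsClosed Y ∧
      ∃ h : Set.MapsTo f^[m] Y Y, ∃ π : Y ≃ₜ (ℕ → Bool),
        ∀ y : Y, (π ⟨f^[m] ↑y, h y.2⟩ : ℕ → Bool) = fun i => (π y) (i + 1)) ∧
      0 < topEntropy f := by
  obtain ⟨U, hU, e, he, hexp'⟩ := id hexp
  obtain ⟨ρ, hρ, hρU⟩ := Metric.mem_nhds_iff.1 hU
  obtain ⟨ε, hε, hερ, hεe⟩ : ∃ ε > 0, ε < ρ ∧ ε < e / 4 := by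
    obtain ⟨ε, h0, h1⟩ := exists_between (show 0 < min ρ (e / 4) by positivity)
    exact ⟨ε, h0, lt_min_iff.1 h1⟩
  obtain ⟨δ, hδ, hsh⟩ := hshad ε hε
  obtain ⟨r, hr, hrδ, hfr⟩ := exists_pos_forall_dist_lt_half hf x hδ
  obtain ⟨a, ha, k, hk, hak⟩ :=
    hshad.exists_isPeriodicPt hf hexp hnw (show 0 < min r ε by positivity)
  have hax : a ≠ x := by
    rintro rfl
    refine hnonper (((Finset.range k).finite_toSet.image fun i => f^[i] a).subset ?_)
    rintro _ ⟨i, rfl⟩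
    exact ⟨i % k, by simpa using Nat.mod_lt i hk, hak.iterate_mod_apply i⟩
  obtain ⟨b, hb, l, hl, hbl⟩ := hshad.exists_isPeriodicPt hf hexp hnw (dist_pos.2 hax)
  have hab : a ≠ b := by
    rintro rfl
    exact lt_irrefl _ hb
  have hb' := hb.trans ha
  set m := k * l
  have hm : 0 < m := Nat.mul_pos hk hl
  have ham : Function.IsPeriodicPt f m a := hak.mul_const l
  have hbm : Function.IsPeriodicPt f m b := hbl.const_mul k
  rw [lt_min_iff] at ha hb'
  obtain ⟨s, hs⟩ : ∃ s, e ≤ dist (f^[s] a) (f^[s] b) := by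
    by_contra! h
    exact hab (hexp' _ (hρU (ha.2.trans hερ)) _ (hρU (hb'.2.trans hερ)) h)
  obtain ⟨s, hs0, hsm, hs⟩ : ∃ s, 0 < s ∧ s < m ∧ e ≤ dist (f^[s] a) (f^[s] b) := by
    rw [← ham.iterate_mod_apply, ← hbm.iterate_mod_apply] at hs
    refine ⟨s % m, Nat.pos_of_ne_zero fun h => ?_, Nat.mod_lt _ hm, hs⟩
    rw [h] at hs
    have := dist_triangle_right a b x
    simp only [Function.iterate_zero, id] at hs
    linarith
  let p : (ℕ → Bool) → ℕ → X := fun c => blockOrbit f x m fun j => if c j then a else b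
  have hp : ∀ c, ∃ y, ∀ i, dist (f^[i] y) (p c i) ≤ ε := fun c => by
    obtain ⟨y, hy⟩ := hsh (p c) (isPseudoOrbit_blockOrbit hm
      (fun j => by split_ifs; exacts [hfr a ha.1, hfr b hb'.1])
      (fun j => by
        split_ifs
        · rw [ham.eq]; exact ha.1.trans_le hrδ
        · rw [hbm.eq]; exact hb'.1.trans_le hrδ)) (blockOrbit_zero ..)
    exact ⟨y, fun i => (hy i).le⟩
  choose Φ hΦ using hp
  have hunique : ∀ c y, (∀ i, dist (f^[i] y) (p c i) ≤ ε) → y = Φ c := fun c y hy => by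
    have hmem : ∀ z, (∀ i, dist (f^[i] z) (p c i) ≤ ε) → z ∈ U := fun z hz =>
      hρU (lt_of_le_of_lt (by simpa [p, blockOrbit_zero] using hz 0) hερ)
    refine hexp' _ (hmem y hy) _ (hmem _ (hΦ c)) fun i => ?_
    linarith [dist_triangle_right (f^[i] y) (f^[i] (Φ c)) (p c i), hy i, hΦ c i]
  have hsep : ∀ c c' j, c j ≠ c' j →
      ∃ i < m, e / 2 ≤ dist (f^[j * m + i] (Φ c)) (f^[j * m + i] (Φ c')) := fun c c' j hne => by
    refine ⟨s, hsm, ?_⟩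
    have hpp : e ≤ dist (p c (j * m + s)) (p c' (j * m + s)) := by
      simp only [p, blockOrbit_mul_add f x _ j hs0 hsm]
      cases hc : c j <;> cases hc' : c' j
      · exact absurd (hc.trans hc'.symm) hne
      · simpa [dist_comm] using hs
      · simpa using hs
      · exact absurd (hc.trans hc'.symm) hne
    have h1 := hΦ c (j * m + s)
    have h2 := hΦ c' (j * m + s)
    rw [dist_comm] at h1
    linarith [dist_triangle4 (p c (j * m + s)) (f^[j * m + s] (Φ c)) (f^[j * m + s] (Φ c'))
      (p c' (j * m + s))]
  have hinj : Function.Injective Φ := fun c c' h => by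
    ext1 j
    by_contra hne
    obtain ⟨i, -, hle⟩ := hsep c c' j hne
    rw [h, dist_self] at hle
    linarith
  have hshift : ∀ c, f^[m] (Φ c) = Φ fun i => c (i + 1) := fun c => by
    refine hunique _ _ fun i => ?_
    rw [← Function.iterate_add_apply]
    simpa only [p, blockOrbit_add_self f x hm] using hΦ c (i + m)
  have hpcont : ∀ i, Continuous fun c => p c i := fun i => by
    have : (fun c => p c i) =
        (fun t : Bool => if i % m = 0 then x else f^[i % m] (if t then a else b)) ∘
          fun c : ℕ → Bool => c (i / m) := rfl
    rw [this]
    exact continuous_of_discreteTopology.comp (continuous_apply _)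
  have hcont : Continuous Φ := by
    refine continuous_of_isClosed_setOf_eq ?_
    have : {q : (ℕ → Bool) × X | q.2 = Φ q.1} = ⋂ i, {q | dist (f^[i] q.2) (p q.1 i) ≤ ε} := by
      ext ⟨c, y⟩
      simp only [Set.mem_ofPred_eq, Set.mem_iInter]
      exact ⟨fun h => h ▸ hΦ c, hunique c y⟩
    rw [this]
    exact isClosed_iInter fun i => isClosed_le
      (((hf.iterate i).comp continuous_snd).dist ((hpcont i).comp continuous_fst))
      continuous_const
  refine ⟨⟨m, hm, Set.range Φ, Set.range_nonempty _, (isCompact_range hcont).isClosed, ?_,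
    (hcont.isClosedEmbedding hinj).isEmbedding.toHomeomorph.symm, ?_⟩,
    topEntropy_pos_of_separated_coding hf hm (half_pos he) hsep⟩
  · rintro _ ⟨c, rfl⟩
    exact ⟨_, (hshift c).symm⟩
  · rintro ⟨_, c, rfl⟩
    simp only [hshift, Topology.IsEmbedding.toHomeomorph_symm_apply]
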